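/- Let ω = ζ₃, S = diag(1,ω,ω²), V = (1/(i·√3))·M where M has rows (1,1,1), (1,ω,ω²), (1,ω²,ω), let ε = exp(4πi/9) (so ε³ = ω²), U = diag(ε,ε,εω), and P = U·V·U⁻¹. Let F ≤ SL(3,ℂ) be the subgroup generated by S, M_τ, V, P (the group F₂₁₆) and H ≤ SL(3,ℂ) the subgroup generated by S, M_τ, V, P, U (the Hessian group H₆₄₈). Then every F-orbit on ℙ² has more than 8 elements, and every H-orbit on ℙ² has more than 8 elements. -/

import Mathlib

open Matrix Complex

noncomputable section

abbrev M3 : Type := Matrix (Fin 3) (Fin 3) ℂ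
abbrev SL3 : Type := Matrix.SpecialLinearGroup (Fin 3) ℂ
abbrev P2 : Type := Projectivization ℂ (Fin 3 → ℂ)

/-- The matrix `M_τ`. -/
def Mtau : M3 := !![0,1,0; 0,0,1; 1,0,0]

/-- `ζ_n = exp(2πi/n)`. -/
def zeta (n : ℕ) : ℂ := Complex.exp (2 * Real.pi * Complex.I / n)

/-- The subgroup of `SL(3,ℂ)` generated by a given set of matrices. -/
def genSL (s : Set M3) : Subgroup SL3 :=
  Subgroup.closure { g : SL3 | (g : M3) ∈ s }

/-- The orbit of a point of `ℙ²` under a set of (invertible) matrices,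
acting by `[v] ↦ [g·v]`. -/
def projOrbit (G : Set M3) (p : P2) : Set P2 :=
  { q | ∃ g ∈ G, ∃ h : g.mulVec p.rep ≠ 0, Projectivization.mk ℂ (g.mulVec p.rep) h = q }

/-- The orbit of a point of `ℙ²` under a subgroup of `SL(3,ℂ)`. -/
def projOrbitSL (G : Subgroup SL3) (p : P2) : Set P2 :=
  projOrbit ((fun g : SL3 => (g : M3)) '' (G : Set SL3)) p

/-- The point `[x:y:z] ∈ ℙ²`. -/
def pt (x y z : ℂ) (h : ![x,y,z] ≠ 0) : P2 := Projectivization.mk ℂ ![x,y,z] h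

lemma vne₀ {x y z : ℂ} (hx : x ≠ 0) : ![x,y,z] ≠ 0 := by
  intro h; exact hx (by simpa using congrFun h 0)

lemma vne₁ {x y z : ℂ} (hy : y ≠ 0) : ![x,y,z] ≠ 0 := by
  intro h; exact hy (by simpa using congrFun h 1)

lemma vne₂ {x y z : ℂ} (hz : z ≠ 0) : ![x,y,z] ≠ 0 := by
  intro h; exact hz (by simpa using congrFun h 2)

/-- No three distinct points of `P` are collinear. -/
def NoThreeCollinear (P : Set P2) : Prop :=
  ∀ p q r, p ∈ P → q ∈ P → r ∈ P → p ≠ q → p ≠ r → q ≠ r →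
    LinearIndependent ℂ ![p.rep, q.rep, r.rep]

/-- The points of `P` all lie on a conic. -/
def LiesOnConic (P : Set P2) : Prop :=
  ∃ Q : QuadraticForm ℂ (Fin 3 → ℂ), Q ≠ 0 ∧ ∀ p ∈ P, Q p.rep = 0

/-- The matrix `S = diag(1, ω, ω²)`, `ω = ζ₃`. -/
def Smat : M3 := Matrix.diagonal ![1, zeta 3, zeta 3 ^ 2]

/-- The matrix `V = (1/(i√3))·M`, where `M` has rows `(1,1,1)`, `(1,ω,ω²)`, `(1,ω²,ω)`. -/
def Vmat : M3 :=
  (Complex.I * (Real.sqrt 3 : ℂ))⁻¹ •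
    !![1, 1, 1; 1, zeta 3, zeta 3 ^ 2; 1, zeta 3 ^ 2, zeta 3]

/-- `ε = exp(4πi/9)`, satisfying `ε³ = ω²`. -/
def eps : ℂ := Complex.exp (4 * Real.pi * Complex.I / 9)

/-- The matrix `U = diag(ε, ε, εω)`. -/
def Umat : M3 := Matrix.diagonal ![eps, eps, eps * zeta 3]

/-- The matrix `P = U·V·U⁻¹`. -/
def Pmat : M3 := Umat * Vmat * Umat⁻¹

/-- The group `F₂₁₆ ≤ SL(3,ℂ)`, generated by `S`, `M_τ`, `V` and `P`. -/
def F216 : Subgroup SL3 := genSL {Smat, Mtau, Vmat, Pmat}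

/-- The Hessian group `H₆₄₈ ≤ SL(3,ℂ)`, generated by `S`, `M_τ`, `V`, `P` and `U`. -/
def H648 : Subgroup SL3 := genSL {Smat, Mtau, Vmat, Pmat, Umat}

lemma zeta_three_isPrimitiveRoot : IsPrimitiveRoot (zeta 3) 3 :=
  Complex.isPrimitiveRoot_exp 3 (by norm_num)

lemma zeta_three_pow : zeta 3 ^ 3 = 1 := zeta_three_isPrimitiveRoot.pow_eq_one

lemma zeta_three_ne_zero : zeta 3 ≠ 0 := zeta_three_isPrimitiveRoot.ne_zero (by norm_num)

lemma zeta_three_ne_one : zeta 3 ≠ 1 := zeta_three_isPrimitiveRoot.ne_one (by norm_num)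

lemma zeta_three_sq : zeta 3 ^ 2 = -1 - zeta 3 := by
  have h : (zeta 3 - 1) * (zeta 3 ^ 2 + zeta 3 + 1) = 0 := by
    linear_combination zeta_three_pow
  rcases mul_eq_zero.mp h with h | h
  · exact absurd (sub_eq_zero.mp h) zeta_three_ne_one
  · linear_combination h

lemma eq_of_pow_three_eq_one {x : ℂ} (hx : x ^ 3 = 1) :
    x = 1 ∨ x = zeta 3 ∨ x = zeta 3 ^ 2 := by
  have h : (x - 1) * ((x - zeta 3) * (x - zeta 3 ^ 2)) = 0 := by
    grind [zeta_three_sq]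
  simpa [sub_eq_zero] using h

lemma I_mul_sqrt_three_eq : Complex.I * (Real.sqrt 3 : ℂ) = 1 + 2 * zeta 3 := by
  have h : zeta 3 = -1 / 2 + Complex.I * (Real.sqrt 3 : ℂ) / 2 := by
    have e : (2 * Real.pi * Complex.I / (3 : ℕ) : ℂ)
        = ((Real.pi - Real.pi / 3 : ℝ) : ℂ) * Complex.I := by
      push_cast
      ring
    rw [zeta, e, Complex.exp_mul_I, ← Complex.ofReal_cos, ← Complex.ofReal_sin,
      Real.cos_pi_sub, Real.sin_pi_sub, Real.cos_pi_div_three, Real.sin_pi_div_three]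
    push_cast
    ring
  rw [h]
  ring

lemma one_add_two_zeta_three_ne_zero : 1 + 2 * zeta 3 ≠ 0 := by
  intro h
  have h3 : (1 + 2 * zeta 3) ^ 2 = -3 := by linear_combination 4 * zeta_three_sq
  rw [h] at h3
  norm_num at h3

lemma eps_ne_zero : eps ≠ 0 := Complex.exp_ne_zero _

lemma det_Smat : Smat.det = 1 := by
  simp [Smat, Matrix.det_diagonal, Fin.prod_univ_three]
  linear_combination zeta_three_pow

lemma det_Mtau : Mtau.det = 1 := by
  simp [Mtau, Matrix.det_fin_three]

lemma det_Vmat : Vmat.det = 1 := by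
  have h := one_add_two_zeta_three_ne_zero
  rw [Vmat, I_mul_sqrt_three_eq, Matrix.det_smul, Matrix.det_fin_three]
  simp
  field_simp
  grind [zeta_three_sq]

lemma isUnit_det_Umat : IsUnit Umat.det := by
  simp [Umat, Matrix.det_diagonal, Fin.prod_univ_three, eps_ne_zero, zeta_three_ne_zero]

lemma det_Pmat : Pmat.det = 1 := by
  rw [Pmat, Matrix.det_conj ((Matrix.isUnit_iff_isUnit_det _).mpr isUnit_det_Umat), det_Vmat]

/-- The vector `w` is, up to a nonzero scalar, an `F₂₁₆`-translate of `v`. -/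
def Reach (v w : Fin 3 → ℂ) : Prop :=
  ∃ g ∈ F216, ∃ c : ℂ, c ≠ 0 ∧ (g : M3) *ᵥ v = c • w

lemma Reach.trans {u v w : Fin 3 → ℂ} (h₁ : Reach u v) (h₂ : Reach v w) : Reach u w := by
  obtain ⟨g, hg, c, hc, h⟩ := h₁
  obtain ⟨g', hg', c', hc', h'⟩ := h₂
  refine ⟨g' * g, mul_mem hg' hg, c * c', mul_ne_zero hc hc', ?_⟩
  rw [Matrix.SpecialLinearGroup.coe_mul, ← Matrix.mulVec_mulVec, h, Matrix.mulVec_smul, h',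
    smul_smul]

lemma Reach.symm {v w : Fin 3 → ℂ} (h : Reach v w) : Reach w v := by
  obtain ⟨g, hg, c, hc, h⟩ := h
  refine ⟨g⁻¹, inv_mem hg, c⁻¹, inv_ne_zero hc, ?_⟩
  have hw : w = c⁻¹ • ((g : M3) *ᵥ v) := by rw [h, smul_smul, inv_mul_cancel₀ hc, one_smul]
  rw [hw, Matrix.mulVec_smul, Matrix.mulVec_mulVec, ← Matrix.SpecialLinearGroup.coe_mul,
    inv_mul_cancel, Matrix.SpecialLinearGroup.coe_one, Matrix.one_mulVec]

lemma reach_smul (v : Fin 3 → ℂ) {c : ℂ} (hc : c ≠ 0) : Reach (c • v) v :=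
  ⟨1, one_mem _, c, hc, by simp⟩

lemma reach_mulVec {A : M3} (hdet : A.det = 1) (hA : A ∈ ({Smat, Mtau, Vmat, Pmat} : Set M3))
    (v : Fin 3 → ℂ) : Reach v (A *ᵥ v) :=
  ⟨⟨A, hdet⟩, Subgroup.subset_closure hA, 1, one_ne_zero, by simp⟩

lemma Smat_mulVec (x y z : ℂ) :
    Smat *ᵥ ![x, y, z] = ![x, zeta 3 * y, zeta 3 ^ 2 * z] := by
  ext i
  fin_cases i <;> simp [Smat, Matrix.mulVec_diagonal]

lemma Mtau_mulVec (x y z : ℂ) : Mtau *ᵥ ![x, y, z] = ![y, z, x] := by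
  ext i
  fin_cases i <;> simp [Mtau, Matrix.mulVec, dotProduct, Fin.sum_univ_three]

lemma Vmat_mulVec (x y z : ℂ) :
    Vmat *ᵥ ![x, y, z] = (1 + 2 * zeta 3)⁻¹ • ![x + y + z, x + zeta 3 * y + zeta 3 ^ 2 * z,
      x + zeta 3 ^ 2 * y + zeta 3 * z] := by
  rw [Vmat, I_mul_sqrt_three_eq, Matrix.smul_mulVec]
  congr 1
  ext i
  fin_cases i <;> simp [Matrix.mulVec, dotProduct, Fin.sum_univ_three]

lemma reach_S (v : Fin 3 → ℂ) : Reach v (Smat *ᵥ v) := reach_mulVec det_Smat (by simp) v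

lemma reach_T (v : Fin 3 → ℂ) : Reach v (Mtau *ᵥ v) := reach_mulVec det_Mtau (by simp) v

lemma reach_V (x y z : ℂ) : Reach ![x, y, z] ![x + y + z, x + zeta 3 * y + zeta 3 ^ 2 * z,
      x + zeta 3 ^ 2 * y + zeta 3 * z] := by
  refine (reach_mulVec det_Vmat (by simp) _).trans ?_
  rw [Vmat_mulVec]
  exact reach_smul _ (inv_ne_zero one_add_two_zeta_three_ne_zero)

lemma Pmat_mulVec_one : Pmat *ᵥ ![1, 1, 1] = zeta 3 ^ 2 • ![1, zeta 3, zeta 3] := by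
  have h1 : (![1, 1, 1] : Fin 3 → ℂ) = Umat *ᵥ (eps⁻¹ • ![1, 1, zeta 3 ^ 2]) := by
    have := eps_ne_zero
    ext i
    fin_cases i <;> simp [Umat, Matrix.mulVec_diagonal, this]
    field_simp
    linear_combination -zeta_three_pow
  have h := one_add_two_zeta_three_ne_zero
  have h2 : Pmat *ᵥ ![1, 1, 1] = Umat *ᵥ (Vmat *ᵥ (eps⁻¹ • ![1, 1, zeta 3 ^ 2])) := by
    rw [h1, Pmat, Matrix.mulVec_mulVec, Matrix.mul_assoc, Matrix.nonsing_inv_mul _ isUnit_det_Umat,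
      Matrix.mul_one, Matrix.mulVec_mulVec]
  have h3 := zeta_three_sq
  rw [h2, Matrix.mulVec_smul, Vmat_mulVec]
  have := eps_ne_zero
  ext i
  fin_cases i <;> simp [Umat, Matrix.mulVec_diagonal] <;> grind

lemma reach_P_one : Reach ![1, 1, 1] ![1, zeta 3, zeta 3] := by
  refine (reach_mulVec det_Pmat (by simp) _).trans ?_
  rw [Pmat_mulVec_one]
  exact reach_smul _ (pow_ne_zero 2 zeta_three_ne_zero)

lemma reach_of_smul_eq {u v w : Fin 3 → ℂ} (h : Reach u v) {c : ℂ} (hc : c ≠ 0)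
    (e : v = c • w) : Reach u w :=
  h.trans (e ▸ reach_smul w hc)

lemma Reach.mul_zeta {u : Fin 3 → ℂ} {x y x' y' : ℂ} (h : Reach u ![1, x, y])
    (hx : x' = zeta 3 * x) (hy : y' = zeta 3 ^ 2 * y) : Reach u ![1, x', y'] := by
  rw [hx, hy, ← Smat_mulVec]
  exact h.trans (reach_S _)

lemma reach_one_refl : Reach ![1, 1, 1] ![1, 1, 1] := (reach_T _).trans (reach_T _).symm

lemma reach_one_zeta_one : Reach ![1, 1, 1] ![1, zeta 3, 1] := by
  have h3 := zeta_three_sq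
  have h0 := zeta_three_ne_one
  have h1 : Reach ![1, 1, 1] ![1, 1, zeta 3 ^ 2] := by
    refine reach_of_smul_eq (reach_P_one.trans (reach_T _)) zeta_three_ne_zero ?_
    rw [Mtau_mulVec]
    ext i
    fin_cases i <;> simp
    linear_combination -zeta_three_pow
  refine reach_of_smul_eq (h1.trans (reach_V _ _ _)) (c := 1 - zeta 3)
    (sub_ne_zero.mpr h0.symm) ?_
  ext i
  fin_cases i <;> simp <;> grind

lemma reach_roots {x y : ℂ} (hx : x ^ 3 = 1) (hy : y ^ 3 = 1) :
    Reach ![1, 1, 1] ![1, x, y] := by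
  have h3 := zeta_three_sq
  have a0 := reach_one_refl
  have a1 := a0.mul_zeta (x' := zeta 3) (y' := zeta 3 ^ 2) (by grind) (by grind)
  have a2 := a1.mul_zeta (x' := zeta 3 ^ 2) (y' := zeta 3) (by grind) (by grind)
  have b0 := reach_P_one
  have b1 := b0.mul_zeta (x' := zeta 3 ^ 2) (y' := 1) (by grind) (by grind)
  have b2 := b1.mul_zeta (x' := 1) (y' := zeta 3 ^ 2) (by grind) (by grind)
  have c0 := reach_one_zeta_one
  have c1 := c0.mul_zeta (x' := zeta 3 ^ 2) (y' := zeta 3 ^ 2) (by grind) (by grind)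
  have c2 := c1.mul_zeta (x' := 1) (y' := zeta 3) (by grind) (by grind)
  rcases eq_of_pow_three_eq_one hx with rfl | rfl | rfl <;>
    rcases eq_of_pow_three_eq_one hy with rfl | rfl | rfl <;> assumption

lemma reach_one_of_coord_zero {v : Fin 3 → ℂ} (hv : v ≠ 0)
    (h : (v 1 = 0 ∧ v 2 = 0) ∨ (v 0 = 0 ∧ v 2 = 0) ∨ (v 0 = 0 ∧ v 1 = 0)) :
    Reach v ![1, 1, 1] := by
  have key (x : ℂ) (hx : x ≠ 0) : Reach ![x, 0, 0] ![1, 1, 1] :=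
    reach_of_smul_eq (reach_V _ _ _) hx (by ext i; fin_cases i <;> simp)
  obtain ⟨x, y, z, rfl⟩ : ∃ x y z, v = ![x, y, z] :=
    ⟨v 0, v 1, v 2, by ext i; fin_cases i <;> rfl⟩
  simp only [Matrix.cons_val] at h
  have h1 := reach_T ![x, y, z]
  have h2 := h1.trans (reach_T _)
  simp only [Mtau_mulVec] at h1 h2
  rcases h with ⟨rfl, rfl⟩ | ⟨rfl, rfl⟩ | ⟨rfl, rfl⟩
  · exact key x (by rintro rfl; exact hv (by simp))
  · exact h1.trans (key y (by rintro rfl; exact hv (by simp)))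
  · exact h2.trans (key z (by rintro rfl; exact hv (by simp)))

lemma Smat_pow_mulVec (i : ℕ) (v : Fin 3 → ℂ) :
    Smat ^ i *ᵥ v = ![v 0, zeta 3 ^ i * v 1, (zeta 3 ^ i) ^ 2 * v 2] := by
  ext k
  fin_cases k <;> simp [Smat, Matrix.diagonal_pow, Matrix.mulVec_diagonal, ← pow_mul, mul_comm]

lemma reach_one_of_Smat_pow {v : Fin 3 → ℂ} (hv : v ≠ 0) {i j : Fin 3} (hij : i ≠ j) {c : ℂ}
    (h : Smat ^ (i : ℕ) *ᵥ v = c • (Smat ^ (j : ℕ) *ᵥ v)) : Reach v ![1, 1, 1] := by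
  apply reach_one_of_coord_zero hv
  rw [Smat_pow_mulVec, Smat_pow_mulVec] at h
  have e0 := congrFun h 0
  have e1 := congrFun h 1
  have e2 := congrFun h 2
  have h3 := zeta_three_pow
  have hne : zeta 3 ^ (i : ℕ) ≠ zeta 3 ^ (j : ℕ) := fun e =>
    hij (Fin.ext (zeta_three_isPrimitiveRoot.pow_inj i.2 j.2 e))
  have hi : (zeta 3 ^ (i : ℕ)) ^ 3 = 1 := by rw [← pow_mul, mul_comm, pow_mul, h3, one_pow]
  have hj : (zeta 3 ^ (j : ℕ)) ^ 3 = 1 := by rw [← pow_mul, mul_comm, pow_mul, h3, one_pow]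
  generalize zeta 3 ^ (i : ℕ) = a at *
  generalize zeta 3 ^ (j : ℕ) = b at *
  simp only [Matrix.cons_val, Pi.smul_apply, smul_eq_mul] at e0 e1 e2
  have ha : a ≠ 0 := by rintro rfl; simp at hi
  have hb : b ≠ 0 := by rintro rfl; simp at hj
  by_cases h0 : v 0 = 0
  · by_cases h1 : v 1 = 0
    · exact .inr (.inr ⟨h0, h1⟩)
    · have : a = c * b := mul_right_cancel₀ h1 (by linear_combination e1)
      grind
  · have hc : c = 1 := mul_right_cancel₀ h0 (by linear_combination -e0)
    subst hc
    have k1 : (a - b) * v 1 = 0 := by linear_combination e1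
    have k2 : (a - b) * v 2 = 0 := by grind
    have hs := sub_ne_zero.mpr hne
    exact .inl ⟨(mul_eq_zero.mp k1).resolve_left hs, (mul_eq_zero.mp k2).resolve_left hs⟩

lemma reach_one_of_Mtau {v : Fin 3 → ℂ} (hv : v ≠ 0) {a c : ℂ} (ha : a ^ 3 = 1)
    (h0 : v 1 = c * v 0) (h1 : v 2 = c * (a * v 1)) (h2 : v 0 = c * (a ^ 2 * v 2)) :
    Reach v ![1, 1, 1] := by
  have hx : v 0 ≠ 0 := by
    intro hx
    rw [hx, mul_zero] at h0
    rw [h0, mul_zero, mul_zero] at h1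
    apply hv
    ext i
    fin_cases i <;> assumption
  have hc : c ^ 3 = 1 := mul_right_cancel₀ hx (by grind)
  have e : v = v 0 • ![1, c, a * c ^ 2] := by
    ext i
    fin_cases i <;> simp <;> grind
  rw [e]
  exact (reach_smul _ hx).trans (reach_roots hc (by grind)).symm

lemma mk_mem_projOrbitSL {p : P2} {w : Fin 3 → ℂ} (hw : w ≠ 0) (h : Reach p.rep w) :
    Projectivization.mk ℂ w hw ∈ projOrbitSL F216 p := by
  obtain ⟨g, hg, c, hc, h⟩ := h
  have h0 : (g : M3) *ᵥ p.rep ≠ 0 := by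
    rw [h]
    exact smul_ne_zero hc hw
  exact ⟨g, ⟨g, hg, rfl⟩, h0, (Projectivization.mk_eq_mk_iff' ℂ _ _ _ _).mpr ⟨c, h.symm⟩⟩

lemma Reach.ne_zero {v w : Fin 3 → ℂ} (h : Reach v w) (hv : v ≠ 0) : w ≠ 0 := by
  rintro rfl
  obtain ⟨g, -, c, hc, h⟩ := h.symm
  rw [Matrix.mulVec_zero] at h
  exact hv ((smul_eq_zero.mp h.symm).resolve_left hc)

lemma eight_lt_encard_of_family {p : P2} (f : Fin 3 × Fin 3 → Fin 3 → ℂ)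
    (hf : ∀ i, Reach p.rep (f i)) (hinj : ∀ i j, ∀ c : ℂ, f i = c • f j → i = j) :
    8 < (projOrbitSL F216 p).encard := by
  have hne i : f i ≠ 0 := (hf i).ne_zero p.rep_nonzero
  have hinj' : Function.Injective fun i => Projectivization.mk ℂ (f i) (hne i) := by
    intro i j hij
    obtain ⟨c, hc⟩ := (Projectivization.mk_eq_mk_iff' ℂ _ _ _ _).mp hij
    exact hinj i j c hc.symm
  have hsub : Set.range (fun i => Projectivization.mk ℂ (f i) (hne i)) ⊆ projOrbitSL F216 p := by
    rintro _ ⟨i, rfl⟩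
    exact mk_mem_projOrbitSL _ (hf i)
  refine lt_of_lt_of_le ?_ (Set.encard_le_encard hsub)
  rw [← Set.image_univ, hinj'.encard_image, Set.encard_univ]
  simp
  norm_num

lemma Reach.Smat_pow {u v : Fin 3 → ℂ} (h : Reach u v) (i : ℕ) : Reach u (Smat ^ i *ᵥ v) := by
  induction i with
  | zero => simpa using h
  | succ i ih =>
    rw [pow_succ', ← Matrix.mulVec_mulVec]
    exact ih.trans (reach_S _)

lemma reach_Mtau_pow (v : Fin 3 → ℂ) (i : ℕ) : Reach v (Mtau ^ i *ᵥ v) := by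
  induction i with
  | zero => simpa using (reach_T v).trans (reach_T v).symm
  | succ i ih =>
    rw [pow_succ', ← Matrix.mulVec_mulVec]
    exact ih.trans (reach_T _)

lemma Mtau_pow_three : Mtau ^ 3 = 1 := by
  ext i j
  fin_cases i <;> fin_cases j <;>
    simp [Mtau, pow_succ, Matrix.mul_apply, Fin.sum_univ_three]

lemma reach_one_of_Mtau_Smat {v : Fin 3 → ℂ} (hv : v ≠ 0) (i j : ℕ) {c : ℂ}
    (h : Smat ^ i *ᵥ (Mtau *ᵥ v) = c • (Smat ^ j *ᵥ v)) : Reach v ![1, 1, 1] := by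
  rw [Smat_pow_mulVec, Smat_pow_mulVec] at h
  have e0 := congrFun h 0
  have e1 := congrFun h 1
  have e2 := congrFun h 2
  have h3 := zeta_three_pow
  have hi : (zeta 3 ^ i) ^ 3 = 1 := by rw [← pow_mul, mul_comm, pow_mul, h3, one_pow]
  have hj : (zeta 3 ^ j) ^ 3 = 1 := by rw [← pow_mul, mul_comm, pow_mul, h3, one_pow]
  generalize zeta 3 ^ i = a at *
  generalize zeta 3 ^ j = b at *
  simp [Mtau, Matrix.mulVec, dotProduct, Fin.sum_univ_three] at e0 e1 e2
  refine reach_one_of_Mtau hv (a := a ^ 2 * b) (c := c) ?_ e0 ?_ ?_ <;> grind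

lemma reach_one_of_not_injective {v : Fin 3 → ℂ} (hv : v ≠ 0) {p q : Fin 3 × Fin 3}
    (hpq : p ≠ q) {c : ℂ}
    (h : Smat ^ (p.1 : ℕ) *ᵥ (Mtau ^ (p.2 : ℕ) *ᵥ v)
      = c • (Smat ^ (q.1 : ℕ) *ᵥ (Mtau ^ (q.2 : ℕ) *ᵥ v))) :
    Reach v ![1, 1, 1] := by
  have hne (k : ℕ) : Mtau ^ k *ᵥ v ≠ 0 := (reach_Mtau_pow v k).ne_zero hv
  have hc : c ≠ 0 := by
    rintro rfl
    rw [zero_smul] at h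
    exact ((reach_Mtau_pow v p.2).Smat_pow p.1).ne_zero hv h
  have h' : Smat ^ (q.1 : ℕ) *ᵥ (Mtau ^ (q.2 : ℕ) *ᵥ v)
      = c⁻¹ • (Smat ^ (p.1 : ℕ) *ᵥ (Mtau ^ (p.2 : ℕ) *ᵥ v)) := by
    rw [h, smul_smul, inv_mul_cancel₀ hc, one_smul]
  have step (k : ℕ) : Mtau ^ (k + 1) *ᵥ v = Mtau *ᵥ (Mtau ^ k *ᵥ v) := by
    rw [pow_succ', Matrix.mulVec_mulVec]
  have wrap : v = Mtau *ᵥ (Mtau ^ 2 *ᵥ v) := by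
    rw [← step, Mtau_pow_three, Matrix.one_mulVec]
  have key (k i j : ℕ) (d : ℂ)
      (e : Smat ^ i *ᵥ (Mtau *ᵥ (Mtau ^ k *ᵥ v)) = d • (Smat ^ j *ᵥ (Mtau ^ k *ᵥ v))) :
      Reach v ![1, 1, 1] :=
    (reach_Mtau_pow v k).trans (reach_one_of_Mtau_Smat (hne k) i j e)
  obtain ⟨i, k⟩ := p
  obtain ⟨j, l⟩ := q
  by_cases hkl : k = l
  · subst hkl
    exact (reach_Mtau_pow v k).trans
      (reach_one_of_Smat_pow (hne k) (fun e => hpq (Prod.ext e rfl)) h)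
  have cyc : ∀ k l : Fin 3, k ≠ l → k = l + 1 ∨ l = k + 1 := by decide
  have wrap' (k : Fin 3) : Mtau ^ ((k + 1 : Fin 3) : ℕ) *ᵥ v = Mtau *ᵥ (Mtau ^ (k : ℕ) *ᵥ v) := by
    fin_cases k
    · exact step 0
    · exact step 1
    · simpa using wrap
  rcases cyc k l hkl with rfl | rfl
  · exact key l i j c (by rw [← wrap']; exact h)
  · exact key k j i c⁻¹ (by rw [← wrap']; exact h')

lemma eight_lt_encard_F216 (p : P2) : 8 < (projOrbitSL F216 p).encard := by
  by_cases hp : Reach p.rep ![1, 1, 1]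
  · have h3 (i : ℕ) : (zeta 3 ^ i) ^ 3 = 1 := by
      rw [← pow_mul, mul_comm, pow_mul, zeta_three_pow, one_pow]
    refine eight_lt_encard_of_family (fun i => ![1, zeta 3 ^ (i.1 : ℕ), zeta 3 ^ (i.2 : ℕ)])
      (fun i => hp.trans (reach_roots (h3 _) (h3 _))) ?_
    rintro ⟨i, k⟩ ⟨j, l⟩ c h
    have e0 := congrFun h 0
    have e1 := congrFun h 1
    have e2 := congrFun h 2
    simp at e0 e1 e2
    subst e0
    rw [one_mul] at e1 e2
    rw [Fin.ext (zeta_three_isPrimitiveRoot.pow_inj i.2 j.2 e1),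
      Fin.ext (zeta_three_isPrimitiveRoot.pow_inj k.2 l.2 e2)]
  · refine eight_lt_encard_of_family
      (fun i => Smat ^ (i.1 : ℕ) *ᵥ (Mtau ^ (i.2 : ℕ) *ᵥ p.rep))
      (fun i => (reach_Mtau_pow _ _).Smat_pow _) fun i j c h => ?_
    by_contra hij
    exact hp (reach_one_of_not_injective p.rep_nonzero hij h)

lemma F216_le_H648 : F216 ≤ H648 :=
  Subgroup.closure_mono fun g hg => by
    simp only [Set.mem_ofPred_eq, Set.mem_insert_iff, Set.mem_singleton_iff] at hg ⊢
    tauto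

/-- every `F₂₁₆`-orbit on `ℙ²` has more than 8 elements, and every
`H₆₄₈`-orbit on `ℙ²` has more than 8 elements. -/
theorem statement13 :
    (∀ p : P2, 8 < (projOrbitSL F216 p).encard) ∧
    (∀ p : P2, 8 < (projOrbitSL H648 p).encard) := by
  refine ⟨eight_lt_encard_F216, fun p => (eight_lt_encard_F216 p).trans_le
    (Set.encard_le_encard ?_)⟩
  rintro q ⟨_, ⟨g, hg, rfl⟩, h⟩
  exact ⟨_, ⟨g, F216_le_H648 hg, rfl⟩, h⟩
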